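/- Let 0 < α < d, let U and V be n×n matrix weights on ℝ^d, and let 1 < p < q < ∞ satisfy 1/p − 1/q > α/d. If the matrix-weighted fractional maximal operator M_{α,U,V} is bounded from L^p(ℝ^d,ℂ^n) to L^q(ℝ^d), and if V^{1/p} is locally integrable, then U(x) = 0 for almost every x ∈ ℝ^d. -/

import Mathlib

open MeasureTheory ENNReal
open scoped NNReal ComplexOrder

noncomputable section

abbrev Rd (d : ℕ) := EuclideanSpace ℝ (Fin d)
abbrev Cn (n : ℕ) := EuclideanSpace ℂ (Fin n)
abbrev Mat (n : ℕ) := Matrix (Fin n) (Fin n) ℂ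

/-- An axis-parallel (half-open) cube in `ℝ^d`. -/
structure Cube (d : ℕ) where
  corner : Fin d → ℝ
  side : ℝ
  side_pos : 0 < side

namespace Cube

/-- The set of points of a cube. -/
def set {d : ℕ} (Q : Cube d) : Set (Rd d) :=
  {x | ∀ i, Q.corner i ≤ x i ∧ x i < Q.corner i + Q.side}

/-- The volume `|Q|` of a cube. -/
def vol {d : ℕ} (Q : Cube d) : ℝ := Q.side ^ d

end Cube

/-- A matrix acting on `ℂ^n` (with the Euclidean norm). -/
def mulVecE {n : ℕ} (A : Mat n) (v : Cn n) : Cn n :=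
  Matrix.toEuclideanLin A v

/-- The operator norm `|A|_op` of a matrix acting on `ℓ²(ℂ^n)`. -/
def opNorm {n : ℕ} (A : Mat n) : ℝ :=
  ‖Matrix.toEuclideanCLM (𝕜 := ℂ) A‖

/-- Real powers of a self-adjoint matrix, defined via diagonalization. -/
def matPow {n : ℕ} (A : Mat n) (r : ℝ) : Mat n :=
  if hA : A.IsHermitian then
    (hA.eigenvectorUnitary : Mat n) *
      Matrix.diagonal (fun i => ((hA.eigenvalues i ^ r : ℝ) : ℂ)) *
      (star hA.eigenvectorUnitary : Mat n)
  else A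

/-- A matrix weight: self-adjoint matrix valued, locally integrable entries,
positive definite a.e. -/
def IsMatrixWeight {d n : ℕ} (U : Rd d → Mat n) : Prop :=
  (∀ i j, MeasureTheory.LocallyIntegrable (fun x => U x i j) volume) ∧
    (∀ᵐ x, (U x).PosDef)

/-- A Young function: convex, increasing, `Φ(0) = 0` and `Φ(t)/t → ∞`. -/
structure IsYoungFunction (Φ : ℝ → ℝ) : Prop where
  convexOn : ConvexOn ℝ (Set.Ici 0) Φ
  monotoneOn : MonotoneOn Φ (Set.Ici 0)
  map_zero : Φ 0 = 0
  tendsto : Filter.Tendsto (fun t => Φ t / t) Filter.atTop Filter.atTop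

/-- The associate Young function `Φ̄(t) = sup_{s>0} (st - Φ(s))`. -/
def assoc (Φ : ℝ → ℝ) : ℝ → ℝ :=
  fun t => sSup ((fun s => s * t - Φ s) '' Set.Ioi (0 : ℝ))

/-- The `B_{p,q}` condition: `∫_1^∞ Φ(t)^{q/p} t^{-q} dt/t < ∞`. -/
def MemBpq (Φ : ℝ → ℝ) (p q : ℝ) : Prop :=
  ∫⁻ t in Set.Ioi (1 : ℝ), ENNReal.ofReal (Φ t ^ (q / p) / t ^ (q + 1)) < ⊤

/-- The `B_p` condition: `∫_1^∞ Φ(t) t^{-p} dt/t < ∞`. -/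
def MemBp (Φ : ℝ → ℝ) (p : ℝ) : Prop :=
  ∫⁻ t in Set.Ioi (1 : ℝ), ENNReal.ofReal (Φ t / t ^ (p + 1)) < ⊤

/-- Localized Luxemburg (Orlicz) norm over a cube, for `ℝ≥0∞`-valued functions. -/
def luxNormE {d : ℕ} (Φ : ℝ → ℝ) (Q : Cube d) (f : Rd d → ℝ≥0∞) : ℝ≥0∞ :=
  sInf {lam : ℝ≥0∞ | 0 < lam ∧ lam < ⊤ ∧
    (∫⁻ x in Q.set, ENNReal.ofReal (Φ ((f x).toReal / lam.toReal))) ≤ ENNReal.ofReal Q.vol}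

/-- Localized Luxemburg (Orlicz) norm over a cube of a real valued function. -/
def luxNorm {d : ℕ} (Φ : ℝ → ℝ) (Q : Cube d) (f : Rd d → ℝ) : ℝ≥0∞ :=
  luxNormE Φ Q fun x => ENNReal.ofReal |f x|

/-- The (unweighted) `L^p` norm of a vector valued function. -/
def lpNorm {d n : ℕ} (p : ℝ) (f : Rd d → Cn n) : ℝ≥0∞ :=
  (∫⁻ x, (‖f x‖₊ : ℝ≥0∞) ^ p) ^ (1 / p)

/-- The matrix-weighted `L^p(W)` norm `(∫ |W^{1/p} f|^p)^{1/p}`. -/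
def wLpNorm {d n : ℕ} (p : ℝ) (W : Rd d → Mat n) (f : Rd d → Cn n) : ℝ≥0∞ :=
  (∫⁻ x, (‖mulVecE (matPow (W x) (1 / p)) (f x)‖₊ : ℝ≥0∞) ^ p) ^ (1 / p)


/-- The matrix-weighted fractional maximal operator `M_{α,U,V}`. -/
def matMaxOp {d n : ℕ} (α p q : ℝ) (U V : Rd d → Mat n) (f : Rd d → Cn n) (x : Rd d) : ℝ≥0∞ :=
  ⨆ (Q : Cube d) (_ : x ∈ Q.set),
    ENNReal.ofReal (Q.vol ^ (α / (d : ℝ) - 1)) *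
      ∫⁻ y in Q.set,
        (‖mulVecE (matPow (U x) (1 / q)) (mulVecE (matPow (V y) (-(1 / p))) (f y))‖₊ : ℝ≥0∞)

section MatrixPowers

variable {n : ℕ}

lemma mulVecE_mul (A B : Mat n) (v : Cn n) : mulVecE (A * B) v = mulVecE A (mulVecE B v) := by
  simp [mulVecE, Matrix.toLpLin_apply, Matrix.mulVec_mulVec]

lemma norm_mulVecE_unitary (W : Matrix.unitaryGroup (Fin n) ℂ) (v : Cn n) :
    ‖mulVecE (W : Mat n) v‖ = ‖v‖ :=
  ContinuousLinearMap.norm_map_of_mem_unitary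
    (Unitary.map_mem (Matrix.toEuclideanCLM (n := Fin n) (𝕜 := ℂ)) W.2) v

lemma norm_mulVecE_matPow {A : Mat n} (hA : A.IsHermitian) (r : ℝ) (v : Cn n) :
    ‖mulVecE (matPow A r) v‖ =
      ‖mulVecE (Matrix.diagonal fun i => ((hA.eigenvalues i ^ r : ℝ) : ℂ))
        (mulVecE (star hA.eigenvectorUnitary : Matrix.unitaryGroup (Fin n) ℂ) v)‖ := by
  rw [matPow, dif_pos hA, mulVecE_mul, mulVecE_mul, norm_mulVecE_unitary]
  rfl

lemma norm_sq_mulVecE_diagonal (c : Fin n → ℝ) (v : Cn n) :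
    ‖mulVecE (Matrix.diagonal fun i => (c i : ℂ)) v‖ ^ 2 = ∑ i, c i ^ 2 * ‖v i‖ ^ 2 := by
  rw [EuclideanSpace.norm_sq_eq]
  simp [mulVecE, Matrix.toLpLin_apply, Matrix.mulVec_diagonal, mul_pow]

lemma norm_mulVecE_matPow_le {A : Mat n} (hA : A.IsHermitian) {r t : ℝ} (hr : 0 ≤ r) (ht : 0 ≤ t)
    (h0 : ∀ i, 0 ≤ hA.eigenvalues i) (h : ∀ i, hA.eigenvalues i ≤ t) (v : Cn n) :
    ‖mulVecE (matPow A r) v‖ ≤ t ^ r * ‖v‖ := by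
  rw [norm_mulVecE_matPow hA,
    ← norm_mulVecE_unitary (star hA.eigenvectorUnitary : Matrix.unitaryGroup (Fin n) ℂ) v]
  generalize mulVecE (star hA.eigenvectorUnitary : Matrix.unitaryGroup (Fin n) ℂ) v = w
  refine (sq_le_sq₀ (norm_nonneg _) (by positivity)).1 ?_
  rw [norm_sq_mulVecE_diagonal, mul_pow, EuclideanSpace.norm_sq_eq, Finset.mul_sum]
  gcongr with i
  · exact Real.rpow_nonneg (h0 i) r
  · exact h0 i
  · exact h i

lemma le_norm_mulVecE_matPow {A : Mat n} (hA : A.IsHermitian) {r t : ℝ} (hr : 0 ≤ r) (ht : 0 ≤ t)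
    (h : ∀ i, t ≤ hA.eigenvalues i) (v : Cn n) :
    t ^ r * ‖v‖ ≤ ‖mulVecE (matPow A r) v‖ := by
  rw [norm_mulVecE_matPow hA,
    ← norm_mulVecE_unitary (star hA.eigenvectorUnitary : Matrix.unitaryGroup (Fin n) ℂ) v]
  generalize mulVecE (star hA.eigenvectorUnitary : Matrix.unitaryGroup (Fin n) ℂ) v = w
  refine (sq_le_sq₀ (by positivity) (norm_nonneg _)).1 ?_
  rw [norm_sq_mulVecE_diagonal, mul_pow, EuclideanSpace.norm_sq_eq, Finset.mul_sum]
  gcongr with i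
  exact h i

lemma mulVecE_matPow_neg_matPow {A : Mat n} (hA : A.PosDef) (r : ℝ) (v : Cn n) :
    mulVecE (matPow A (-r)) (mulVecE (matPow A r) v) = v := by
  have hD : (Matrix.diagonal fun i => ((hA.1.eigenvalues i ^ (-r) : ℝ) : ℂ)) *
      (Matrix.diagonal fun i => ((hA.1.eigenvalues i ^ r : ℝ) : ℂ)) = 1 := by
    rw [Matrix.diagonal_mul_diagonal, ← Matrix.diagonal_one]
    congr 1
    funext i
    rw [← Complex.ofReal_mul, ← Real.rpow_add (hA.eigenvalues_pos i)]
    simp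
  have hM : matPow A (-r) * matPow A r = 1 := by
    rw [matPow, matPow, dif_pos hA.1, dif_pos hA.1]
    generalize Matrix.diagonal (fun i => ((hA.1.eigenvalues i ^ (-r) : ℝ) : ℂ)) = D,
      Matrix.diagonal (fun i => ((hA.1.eigenvalues i ^ r : ℝ) : ℂ)) = E at hD ⊢
    set W := hA.1.eigenvectorUnitary
    have hW : (star W : Mat n) * (W : Mat n) = 1 := Unitary.coe_star_mul_self W
    have hW' : (W : Mat n) * (star W : Mat n) = 1 := Unitary.coe_mul_star_self W
    calc _ = (W : Mat n) * D * ((star W : Mat n) * (W : Mat n)) * E * (star W : Mat n) := by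
          simp only [mul_assoc]
      _ = (W : Mat n) * (D * E) * (star W : Mat n) := by
          rw [hW]; simp only [mul_assoc, mul_one]
      _ = 1 := by rw [hD, mul_one, hW']
  rw [← mulVecE_mul, hM]
  simp [mulVecE]

lemma re_trace_eq_sum_eigenvalues {A : Mat n} (hA : A.IsHermitian) :
    A.trace.re = ∑ i, hA.eigenvalues i := by
  simp [hA.trace_eq_sum_eigenvalues]

lemma eigenvalues_le_re_trace {A : Mat n} (hA : A.PosDef) (i : Fin n) :
    hA.1.eigenvalues i ≤ A.trace.re := by
  rw [re_trace_eq_sum_eigenvalues hA.1]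
  exact Finset.single_le_sum (fun j _ => (hA.eigenvalues_pos j).le) (Finset.mem_univ i)

lemma re_trace_pos [NeZero n] {A : Mat n} (hA : A.PosDef) : 0 < A.trace.re :=
  (hA.eigenvalues_pos 0).trans_le (eigenvalues_le_re_trace hA 0)

lemma re_det_eq_prod_eigenvalues {A : Mat n} (hA : A.IsHermitian) :
    A.det.re = ∏ i, hA.eigenvalues i := by
  rw [hA.det_eq_prod_eigenvalues]
  exact_mod_cast Complex.ofReal_re (∏ i, hA.eigenvalues i)

lemma re_det_div_le_eigenvalues [NeZero n] {A : Mat n} (hA : A.PosDef) (i : Fin n) :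
    A.det.re / A.trace.re ^ (n - 1) ≤ hA.1.eigenvalues i := by
  rw [div_le_iff₀ (pow_pos (re_trace_pos hA) _), re_det_eq_prod_eigenvalues hA.1,
    ← Finset.mul_prod_erase Finset.univ _ (Finset.mem_univ i)]
  refine mul_le_mul_of_nonneg_left ?_ (hA.eigenvalues_pos i).le
  calc _ ≤ ∏ _j ∈ Finset.univ.erase i, A.trace.re :=
        Finset.prod_le_prod (fun j _ => (hA.eigenvalues_pos j).le)
          fun j _ => eigenvalues_le_re_trace hA j
    _ = _ := by simp

end MatrixPowers

lemma Cube.measurableSet_set {d : ℕ} (Q : Cube d) : MeasurableSet Q.set := by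
  simp only [Cube.set, Set.ofPred_forall, Set.ofPred_and]
  refine .iInter fun i => .inter ?_ ?_
  · exact measurableSet_le (by fun_prop) (by fun_prop)
  · exact measurableSet_lt (by fun_prop) (by fun_prop)

/-- A cube of side `3r` containing the closed ball of radius `r` around `x`. -/
def Cube.aroundBall {d : ℕ} (x : Rd d) {r : ℝ} (hr : 0 < r) : Cube d where
  corner i := x i - r
  side := 3 * r
  side_pos := by positivity

lemma Cube.closedBall_subset_aroundBall {d : ℕ} (x : Rd d) {r : ℝ} (hr : 0 < r) :
    Metric.closedBall x r ⊆ (Cube.aroundBall x hr).set := by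
  intro y hy i
  have h : |y i - x i| ≤ r := by
    rw [mem_closedBall_iff_norm] at hy
    exact (PiLp.norm_apply_le (y - x) i).trans hy
  rw [abs_le] at h
  simp only [Cube.aroundBall]
  constructor <;> linarith

lemma isLocallyFiniteMeasure_withDensity_enorm {d : ℕ} {E : Type*} [NormedAddCommGroup E]
    {g : Rd d → E} (hg : LocallyIntegrable g volume) :
    IsLocallyFiniteMeasure (volume.withDensity fun x => ‖g x‖ₑ) where
  finiteAtNhds x := by
    obtain ⟨s, hs, hgs⟩ := hg x
    obtain ⟨t, hts, ht, hxt⟩ := mem_nhds_iff.1 hs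
    refine ⟨t, ht.mem_nhds hxt, ?_⟩
    rw [withDensity_apply _ ht.measurableSet]
    exact (hgs.mono_set hts).hasFiniteIntegral

/-- Testing the boundedness of `M_{α,U,V}` on `χ_B V^{1/p} e` for a ball `B` and a unit vector `e`,
over a set on which the eigenvalues of `U` are bounded below. -/
lemma matMaxOp_test_closedBall {d n : ℕ} [NeZero n] {α p q C t : ℝ} (hp : 0 < p) (hq : 0 < q)
    (ht : 0 ≤ t) {U V : Rd d → Mat n} (hV : ∀ᵐ x, (V x).PosDef)
    (hbound : ∀ f : Rd d → Cn n,
      (∫⁻ x, matMaxOp α p q U V f x ^ q) ^ (1 / q) ≤ ENNReal.ofReal C * lpNorm p f)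
    {A : Set (Rd d)} (hA : MeasurableSet A)
    (hUA : ∀ᵐ x, x ∈ A → ∃ h : (U x).IsHermitian, ∀ i, t ≤ h.eigenvalues i)
    (x : Rd d) {r : ℝ} (hr : 0 < r) :
    ENNReal.ofReal ((Cube.aroundBall x hr).vol ^ (α / (d : ℝ) - 1)) *
        (ENNReal.ofReal (t ^ (1 / q)) * volume (Metric.closedBall x r)) *
        volume (A ∩ Metric.closedBall x r) ^ (1 / q) ≤
      ENNReal.ofReal C *
        (volume.withDensity fun y => ‖(V y).trace‖ₑ) (Metric.closedBall x r) ^ (1 / p) := by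
  set B := Metric.closedBall x r
  have hB : MeasurableSet B := Metric.isClosed_closedBall.measurableSet
  set e : Cn n := EuclideanSpace.single 0 1
  have he : ‖e‖ = 1 := by simp [e]
  set f : Rd d → Cn n := B.indicator fun y => mulVecE (matPow (V y) (1 / p)) e
  have hf : lpNorm p f ≤ (volume.withDensity fun y => ‖(V y).trace‖ₑ) B ^ (1 / p) := by
    refine ENNReal.rpow_le_rpow ?_ (by positivity)
    rw [withDensity_apply _ hB, ← lintegral_indicator hB]
    refine lintegral_mono_ae ?_
    filter_upwards [hV] with y hy
    by_cases hyB : y ∈ B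
    · have h0 := (re_trace_pos hy).le
      have h := norm_mulVecE_matPow_le hy.1 (r := 1 / p) (by positivity) h0
        (fun i => (hy.eigenvalues_pos i).le) (eigenvalues_le_re_trace hy) e
      rw [he, mul_one] at h
      rw [Set.indicator_of_mem hyB]
      simp only [f, Set.indicator_of_mem hyB]
      rw [← enorm_eq_nnnorm, ← ofReal_norm, ← ofReal_norm,
        ENNReal.ofReal_rpow_of_nonneg (norm_nonneg _) hp.le]
      refine ENNReal.ofReal_le_ofReal ?_
      calc _ ≤ ((V y).trace.re ^ (1 / p)) ^ p := by gcongr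
        _ = (V y).trace.re := by
          rw [← Real.rpow_mul h0, one_div_mul_cancel hp.ne', Real.rpow_one]
        _ ≤ _ := Complex.re_le_norm _
    · simp [f, hyB, hp]
  set Q := Cube.aroundBall x hr
  have hBQ : B ⊆ Q.set := Cube.closedBall_subset_aroundBall x hr
  set K := ENNReal.ofReal (Q.vol ^ (α / (d : ℝ) - 1)) *
    (ENNReal.ofReal (t ^ (1 / q)) * volume B) with hK
  have hM : ∀ᵐ z, z ∈ A ∩ B → K ^ q ≤ matMaxOp α p q U V f z ^ q := by
    filter_upwards [hUA] with z hz hzAB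
    obtain ⟨hzh, hzt⟩ := hz hzAB.1
    refine ENNReal.rpow_le_rpow ?_ hq.le
    refine le_trans ?_ (le_iSup₂_of_le Q (hBQ hzAB.2) le_rfl)
    refine mul_le_mul_right ?_ _
    rw [← setLIntegral_const]
    refine le_trans ?_ (lintegral_mono_set hBQ)
    refine lintegral_mono_ae ?_
    filter_upwards [ae_restrict_of_ae hV, ae_restrict_mem hB] with y hy hyB
    simp only [f, Set.indicator_of_mem hyB]
    rw [mulVecE_matPow_neg_matPow hy, ← enorm_eq_nnnorm, ← ofReal_norm]
    refine ENNReal.ofReal_le_ofReal ?_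
    simpa [he] using le_norm_mulVecE_matPow hzh (r := 1 / q) (by positivity) ht hzt e
  have hAB : MeasurableSet (A ∩ B) := hA.inter hB
  calc K * volume (A ∩ B) ^ (1 / q) = (∫⁻ _ in A ∩ B, K ^ q) ^ (1 / q) := by
        rw [setLIntegral_const, ENNReal.mul_rpow_of_nonneg _ _ (by positivity),
          ← ENNReal.rpow_mul, mul_one_div_cancel hq.ne', ENNReal.rpow_one]
    _ ≤ (∫⁻ z, matMaxOp α p q U V f z ^ q) ^ (1 / q) := by
        refine ENNReal.rpow_le_rpow ?_ (by positivity)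
        exact (lintegral_mono_ae ((ae_restrict_iff' hAB).2 hM)).trans (setLIntegral_le_lintegral _ _)
    _ ≤ _ := (hbound f).trans (mul_le_mul_right hf _)

lemma exists_eigenvalues_bounded_below {d n : ℕ} [NeZero n] {U : Rd d → Mat n}
    (hU : IsMatrixWeight U) :
    ∃ t : ℝ, 0 < t ∧ ∃ A : Set (Rd d), MeasurableSet A ∧ volume A ≠ 0 ∧
      ∀ᵐ x, x ∈ A → ∃ h : (U x).IsHermitian, ∀ i, t ≤ h.eigenvalues i := by
  have hm : ∀ i j, AEMeasurable (fun x => U x i j) volume := fun i j =>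
    (hU.1 i j).aestronglyMeasurable.aemeasurable
  set g : Rd d → ℝ := fun x => (U x).det.re / (U x).trace.re ^ (n - 1)
  have hg : AEMeasurable g volume := by
    simp only [g, Matrix.det_apply, Matrix.trace, Matrix.diag_apply]
    refine .div (Complex.measurable_re.comp_aemeasurable ?_)
      (.pow_const (Complex.measurable_re.comp_aemeasurable ?_) _)
    · refine Finset.aemeasurable_fun_sum _ fun σ _ => .const_smul ?_ _
      exact Finset.aemeasurable_fun_prod _ fun i _ => hm _ _
    · exact Finset.aemeasurable_fun_sum _ fun i _ => hm _ _
  have hgpos : ∀ᵐ x, 0 < hg.mk g x := by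
    filter_upwards [hU.2, hg.ae_eq_mk] with x hx hgx
    rw [← hgx]
    refine div_pos ?_ (pow_pos (re_trace_pos hx) _)
    rw [re_det_eq_prod_eigenvalues hx.1]
    exact Finset.prod_pos fun i _ => hx.eigenvalues_pos i
  obtain ⟨k, hk⟩ : ∃ k : ℕ, volume {x | 1 / ((k : ℝ) + 1) ≤ hg.mk g x} ≠ 0 := by
    by_contra! h
    have h' : ∀ᵐ x, ∀ k : ℕ, ¬ 1 / ((k : ℝ) + 1) ≤ hg.mk g x :=
      ae_all_iff.2 fun k => by simpa [ae_iff] using h k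
    have : ∀ᵐ _ : Rd d, False := by
      filter_upwards [hgpos, h'] with x hx hx'
      obtain ⟨k, hk⟩ := exists_nat_one_div_lt hx
      exact hx' k hk.le
    simp only [Filter.eventually_false_iff_eq_bot, ae_eq_bot] at this
    exact NeZero.ne (volume : Measure (Rd d)) this
  refine ⟨1 / ((k : ℝ) + 1), by positivity, _, measurableSet_le measurable_const
    hg.measurable_mk, hk, ?_⟩
  filter_upwards [hU.2, hg.ae_eq_mk] with x hx hgx hxA
  refine ⟨hx.1, fun i => le_trans ?_ (re_det_div_le_eigenvalues hx i)⟩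
  exact (show _ ≤ hg.mk g x from hxA).trans_eq hgx.symm

lemma locallyIntegrable_trace {d n : ℕ} {U : Rd d → Mat n} (hU : IsMatrixWeight U) :
    LocallyIntegrable (fun x => (U x).trace) volume := by
  simp only [Matrix.trace, Matrix.diag_apply]
  exact locallyIntegrable_finsetSum _ fun i _ => hU.1 i i

/-- A negative power of `R` is not bounded as `R → 0⁺`. -/
lemma not_eventually_rpow_mul_le {a b c c' : ℝ} (hab : a < b) (hc : 0 < c) :
    ¬ ∀ᶠ R : ℝ in nhdsWithin 0 (Set.Ioi 0), c * R ^ a ≤ c' * R ^ b := by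
  intro h
  have hlim : Filter.Tendsto (fun R : ℝ => c' * R ^ (b - a)) (nhdsWithin 0 (Set.Ioi 0))
      (nhds (c' * 0 ^ (b - a))) :=
    ((Real.continuousAt_rpow_const 0 _ (.inr (sub_pos.2 hab).le)).tendsto.mono_left
      nhdsWithin_le_nhds).const_mul c'
  rw [Real.zero_rpow (sub_pos.2 hab).ne', mul_zero] at hlim
  have : c ≤ 0 := by
    refine ge_of_tendsto hlim ?_
    filter_upwards [h, self_mem_nhdsWithin] with R hR (hR0 : 0 < R)
    rw [Real.rpow_sub hR0, ← mul_div_assoc, le_div_iff₀ (Real.rpow_pos_of_pos hR0 _)]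
    exact hR
  exact hc.not_ge this

/-- **Proposition 3.1.** If `1/p - 1/q > α/d` and `M_{α,U,V} : L^p → L^q` is bounded, with
`V^{1/p}` locally integrable, then `U = 0` a.e. -/
theorem maximal_bounded_implies_trivial {d n : ℕ} (α p q : ℝ)
    (hα0 : 0 < α) (hαd : α < d) (hp : 1 < p) (hpq : p < q)
    (hexp : α / (d : ℝ) < 1 / p - 1 / q)
    (U V : Rd d → Mat n) (hU : IsMatrixWeight U) (hV : IsMatrixWeight V)
    (hVloc : ∀ i j, MeasureTheory.LocallyIntegrable (fun x => matPow (V x) (1 / p) i j) volume)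
    (hbound : ∃ C : ℝ, 0 < C ∧ ∀ f : Rd d → Cn n,
      (∫⁻ x, matMaxOp α p q U V f x ^ q) ^ (1 / q) ≤ ENNReal.ofReal C * lpNorm p f) :
    ∀ᵐ x, U x = 0 := by
  have hp0 : 0 < p := one_pos.trans hp
  have hq0 : 0 < q := hp0.trans hpq
  have hd : 0 < (d : ℝ) := hα0.trans hαd
  rcases Nat.eq_zero_or_pos n with rfl | hn
  · exact .of_forall fun x => Subsingleton.elim _ _
  have : NeZero n := ⟨hn.ne'⟩
  exfalso
  obtain ⟨C, hC, hbound⟩ := hbound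
  obtain ⟨t, ht, A, hA, hA0, hUA⟩ := exists_eigenvalues_bounded_below hU
  set μ : Measure (Rd d) := volume.withDensity fun y => ‖(V y).trace‖ₑ
  have : IsLocallyFiniteMeasure μ :=
    isLocallyFiniteMeasure_withDensity_enorm (locallyIntegrable_trace hV)
  have : NeZero (volume.restrict A) := ⟨by simpa using hA0⟩
  obtain ⟨x, hxA, hxμ, hxtop⟩ :=
    ((Besicovitch.ae_tendsto_measure_inter_div volume A).and
      ((ae_restrict_of_ae (Besicovitch.ae_tendsto_rnDeriv μ volume)).and
        (ae_restrict_of_ae (μ.rnDeriv_lt_top volume)))).exists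
  obtain ⟨L, hL, -⟩ := ENNReal.lt_iff_exists_nnreal_btwn.1 hxtop
  set ω : ℝ := volume.real (Metric.ball (0 : Rd d) 1)
  have hω : 0 < ω := ENNReal.toReal_pos (Metric.measure_ball_pos _ _ one_pos).ne'
    measure_ball_lt_top.ne
  have hball : ∀ r : ℝ, 0 < r →
      volume (Metric.closedBall x r) = ENNReal.ofReal (r ^ d * ω) := fun r hr => by
    rw [Measure.addHaar_closedBall _ _ hr.le, finrank_euclideanSpace_fin,
      ENNReal.ofReal_mul (by positivity), ofReal_measureReal measure_ball_lt_top.ne]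
  have hexp' : α / d - 1 + 1 + 1 / q < 1 / p := by linarith
  refine not_eventually_rpow_mul_le (c := (3 ^ d) ^ (α / (d : ℝ) - 1) * (t ^ (1 / q) * ω) *
    (ω / 2) ^ (1 / q)) (c' := C * (L * ω) ^ (1 / p)) hexp' (by positivity) ?_
  have hroot : Filter.Tendsto (fun R : ℝ => R ^ (1 / (d : ℝ))) (nhdsWithin 0 (Set.Ioi 0))
      (nhdsWithin 0 (Set.Ioi 0)) := by
    refine tendsto_nhdsWithin_iff.2 ⟨?_, ?_⟩
    · have h := (Real.continuousAt_rpow_const 0 (1 / (d : ℝ)) (.inr (by positivity))).tendsto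
      rw [Real.zero_rpow (by positivity)] at h
      exact h.mono_left nhdsWithin_le_nhds
    · filter_upwards [self_mem_nhdsWithin] with R hR using Real.rpow_pos_of_pos hR _
  have hhalf : (2⁻¹ : ℝ≥0∞) < 1 := by simp
  filter_upwards [hroot.eventually (hxA.eventually_const_lt hhalf),
    hroot.eventually (hxμ.eventually_lt_const hL), self_mem_nhdsWithin] with R h1 h2 (hR : 0 < R)
  set r := R ^ (1 / (d : ℝ))
  have hr : 0 < r := Real.rpow_pos_of_pos hR _
  have hrd : r ^ d = R := by
    rw [← Real.rpow_natCast, ← Real.rpow_mul hR.le, one_div_mul_cancel hd.ne', Real.rpow_one]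
  have hB := hball r hr
  rw [hrd] at hB
  have hB0 : ENNReal.ofReal (R * ω) ≠ 0 := by simpa using by positivity
  have h1' : ENNReal.ofReal (R * ω / 2) ≤ volume (A ∩ Metric.closedBall x r) := by
    rw [hB, ENNReal.lt_div_iff_mul_lt (.inl hB0) (.inl ofReal_ne_top)] at h1
    refine le_trans (le_of_eq ?_) h1.le
    rw [div_eq_inv_mul, ENNReal.ofReal_mul (by positivity), ENNReal.ofReal_inv_of_pos two_pos]
    simp
  have h2' : μ (Metric.closedBall x r) ≤ ENNReal.ofReal (L * (R * ω)) := by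
    rw [hB, ENNReal.div_lt_iff (.inl hB0) (.inl ofReal_ne_top)] at h2
    refine h2.le.trans_eq ?_
    rw [ENNReal.ofReal_mul L.coe_nonneg, ENNReal.ofReal_coe_nnreal]
  have hvol : (Cube.aroundBall x hr).vol = 3 ^ d * R := by
    simp [Cube.vol, Cube.aroundBall, mul_pow, hrd]
  have key := matMaxOp_test_closedBall hp0 hq0 ht.le hV.2 hbound hA hUA x hr
  rw [hvol, hB] at key
  replace key := (mul_le_mul_right (ENNReal.rpow_le_rpow h1' (by positivity)) _).trans
    (key.trans (mul_le_mul_right (ENNReal.rpow_le_rpow h2' (by positivity)) _))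
  rw [ENNReal.ofReal_rpow_of_nonneg (by positivity) (by positivity),
    ENNReal.ofReal_rpow_of_nonneg (by positivity) (by positivity),
    ← ENNReal.ofReal_mul (by positivity), ← ENNReal.ofReal_mul (by positivity),
    ← ENNReal.ofReal_mul (by positivity), ← ENNReal.ofReal_mul (by positivity),
    ENNReal.ofReal_le_ofReal_iff (by positivity)] at key
  convert key using 1
  · rw [Real.rpow_add hR, Real.rpow_add hR, Real.rpow_one,
      Real.mul_rpow (by positivity) hR.le, mul_div_assoc, Real.mul_rpow hR.le (by positivity)]
    ring
  · rw [show (L : ℝ) * (R * ω) = L * ω * R by ring, Real.mul_rpow (by positivity) hR.le]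
    ring

end
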